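/- arXiv:1407.2388 — 3 statements merged into one kernel-verified Lean document; each statement's English description precedes it below -/
import Mathlib

section
/- The Riemann zeta value ζ(3) admits the iterated integral representation ζ(3) = ∫∫∫_{0 < x < y < z < 1} dx dy dz / ((1 − x) y z), where the triple integral is the Lebesgue integral of the function (x, y, z) ↦ 1/((1 − x)·y·z) over the open simplex {(x, y, z) ∈ ℝ³ : 0 < x < y < z < 1}. -/
open MeasureTheory

lemma zt_pow (n : ℕ) (a : ℝ) (ha : 0 ≤ a) :
    ∫⁻ x, (Set.Ioo 0 a).indicator (fun x : ℝ => ENNReal.ofReal (x ^ n)) x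
      = ENNReal.ofReal (a ^ (n + 1) / ((n : ℝ) + 1)) := by
  rw [lintegral_indicator measurableSet_Ioo, ← ofReal_integral_eq_lintegral_ofReal]
  · rw [← integral_Ioc_eq_integral_Ioo, ← intervalIntegral.integral_of_le ha, integral_pow]
    simp
  · exact ((continuous_pow n).integrableOn_Icc).mono_set Set.Ioo_subset_Icc_self
  · filter_upwards [ae_restrict_mem measurableSet_Ioo] with x hx
    exact pow_nonneg hx.1.le n

/-- The simplex. -/
def ztS : Set (ℝ × ℝ × ℝ) :=
  {p : ℝ × ℝ × ℝ | 0 < p.1 ∧ p.1 < p.2.1 ∧ p.2.1 < p.2.2 ∧ p.2.2 < 1}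

lemma ztS_meas : MeasurableSet ztS := by
  unfold ztS
  have a : MeasurableSet {p : ℝ × ℝ × ℝ | 0 < p.1} :=
    measurableSet_lt (by fun_prop) (by fun_prop)
  have b : MeasurableSet {p : ℝ × ℝ × ℝ | p.1 < p.2.1} :=
    measurableSet_lt (by fun_prop) (by fun_prop)
  have c : MeasurableSet {p : ℝ × ℝ × ℝ | p.2.1 < p.2.2} :=
    measurableSet_lt (by fun_prop) (by fun_prop)
  have d : MeasurableSet {p : ℝ × ℝ × ℝ | p.2.2 < 1} :=
    measurableSet_lt (by fun_prop) (by fun_prop)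
  exact a.inter (b.inter (c.inter d))

/-- The n-th term. -/
noncomputable def ztG (n : ℕ) : ℝ × ℝ × ℝ → ENNReal :=
  ztS.indicator (fun p => ENNReal.ofReal (p.1 ^ n * (p.2.1⁻¹ * p.2.2⁻¹)))

lemma ztG_meas (n : ℕ) : Measurable (ztG n) := by
  refine Measurable.indicator ?_ ztS_meas
  fun_prop

lemma ztG_eq (n : ℕ) (x y z : ℝ) : ztG n (x, y, z) =
    (Set.Ioo 0 y).indicator (fun x : ℝ => ENNReal.ofReal (x ^ n)) x *
      ((Set.Ioo 0 z).indicator (fun y : ℝ => ENNReal.ofReal y⁻¹) y *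
       (Set.Ioo 0 1).indicator (fun z : ℝ => ENNReal.ofReal z⁻¹) z) := by
  by_cases h : (x, y, z) ∈ ztS
  · obtain ⟨h1, h2, h3, h4⟩ := id h
    simp only at h1 h2 h3 h4
    have hy : 0 < y := h1.trans h2
    have hz : 0 < z := hy.trans h3
    have m1 : x ∈ Set.Ioo 0 y := ⟨h1, h2⟩
    have m2 : y ∈ Set.Ioo 0 z := ⟨hy, h3⟩
    have m3 : z ∈ Set.Ioo (0 : ℝ) 1 := ⟨hz, h4⟩
    rw [ztG, Set.indicator_of_mem h, Set.indicator_of_mem m1, Set.indicator_of_mem m2,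
      Set.indicator_of_mem m3, ENNReal.ofReal_mul (by positivity),
      ENNReal.ofReal_mul (by positivity)]
  · rw [ztG, Set.indicator_of_notMem h]
    by_cases h1 : x ∈ Set.Ioo 0 y
    · by_cases h2 : y ∈ Set.Ioo 0 z
      · by_cases h3 : z ∈ Set.Ioo (0 : ℝ) 1
        · exact absurd ⟨h1.1, h1.2, h2.2, h3.2⟩ h
        · simp [Set.indicator_of_notMem h3]
      · simp [Set.indicator_of_notMem h2]
    · simp [Set.indicator_of_notMem h1]

lemma zt_step (n : ℕ) (z y : ℝ) :
    ENNReal.ofReal (y ^ (n + 1) / ((n : ℝ) + 1)) *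
      (Set.Ioo 0 z).indicator (fun y : ℝ => ENNReal.ofReal y⁻¹) y =
    ENNReal.ofReal (1 / ((n : ℝ) + 1)) *
      (Set.Ioo 0 z).indicator (fun y : ℝ => ENNReal.ofReal (y ^ n)) y := by
  by_cases h : y ∈ Set.Ioo 0 z
  · have hy := h.1
    rw [Set.indicator_of_mem h, Set.indicator_of_mem h, ← ENNReal.ofReal_mul (by positivity),
      ← ENNReal.ofReal_mul (by positivity)]
    congr 1
    field_simp
    ring
  · simp [Set.indicator_of_notMem h]

lemma zt_ind_meas (n : ℕ) (a : ℝ) :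
    Measurable ((Set.Ioo 0 a).indicator (fun x : ℝ => ENNReal.ofReal (x ^ n))) :=
  Measurable.indicator (by fun_prop) measurableSet_Ioo

lemma ztG_x (n : ℕ) (y z : ℝ) : ∫⁻ x, ztG n (x, y, z) =
    ENNReal.ofReal (1 / ((n : ℝ) + 1)) *
      (Set.Ioo 0 z).indicator (fun y : ℝ => ENNReal.ofReal (y ^ n)) y *
       (Set.Ioo 0 1).indicator (fun z : ℝ => ENNReal.ofReal z⁻¹) z := by
  simp_rw [ztG_eq]
  rw [lintegral_mul_const _ (zt_ind_meas n y), ← zt_step, ← mul_assoc]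
  by_cases h : y ∈ Set.Ioo 0 z
  · rw [zt_pow n y h.1.le]
  · simp [Set.indicator_of_notMem h]

lemma ztG_int (n : ℕ) : ∫⁻ p, ztG n p = ENNReal.ofReal (1 / ((n : ℝ) + 1) ^ 3) := by
  rw [Measure.volume_eq_prod, lintegral_prod_symm' _ (ztG_meas n), Measure.volume_eq_prod,
    lintegral_prod_symm' _ (ztG_meas n).lintegral_prod_left']
  have hz : ∀ z : ℝ, ∫⁻ y, ∫⁻ x, ztG n (x, y, z) =
      ENNReal.ofReal (1 / ((n : ℝ) + 1)) * (ENNReal.ofReal (1 / ((n : ℝ) + 1)) *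
      (Set.Ioo 0 1).indicator (fun y : ℝ => ENNReal.ofReal (y ^ n)) z) := by
    intro z
    simp_rw [ztG_x]
    rw [lintegral_mul_const _ ((zt_ind_meas n z).const_mul _),
      lintegral_const_mul _ (zt_ind_meas n z), ← zt_step, mul_assoc]
    by_cases h : z ∈ Set.Ioo (0 : ℝ) 1
    · rw [zt_pow n z h.1.le]
    · simp [Set.indicator_of_notMem h]
  simp_rw [hz]
  rw [lintegral_const_mul _ ((zt_ind_meas n 1).const_mul _),
    lintegral_const_mul _ (zt_ind_meas n 1), zt_pow n 1 zero_le_one,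
    ← ENNReal.ofReal_mul (by positivity), ← ENNReal.ofReal_mul (by positivity)]
  congr 1
  field_simp
  simp

lemma zt_sum (p : ℝ × ℝ × ℝ) : ztS.indicator
    (fun p => ENNReal.ofReal (1 / ((1 - p.1) * p.2.1 * p.2.2))) p = ∑' n, ztG n p := by
  by_cases h : p ∈ ztS
  · obtain ⟨h1, h2, h3, h4⟩ := id h
    have hy : 0 < p.2.1 := h1.trans h2
    have hz : 0 < p.2.2 := hy.trans h3
    have hx : p.1 < 1 := h2.trans (h3.trans h4)
    have hs := (hasSum_geometric_of_lt_one h1.le hx).mul_right (p.2.1⁻¹ * p.2.2⁻¹)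
    simp only [ztG, Set.indicator_of_mem h]
    rw [← ENNReal.ofReal_tsum_of_nonneg (fun n => by positivity) hs.summable, hs.tsum_eq]
    congr 1
    rw [one_div, mul_inv, mul_inv, mul_assoc]
  · simp [ztG, Set.indicator_of_notMem h]

/-- Apéry's constant ζ(3) = ∑_{n≥1} 1/n³ admits the iterated integral representation
ζ(3) = ∫∫∫_{0 < x < y < z < 1} dx dy dz / ((1 − x)·y·z), the Lebesgue integral over
the open simplex in ℝ³. -/
theorem zeta_three_eq_iterated_integral :
    (∑' n : ℕ, 1 / ((n : ℝ) + 1) ^ 3) =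
      ∫ p in {p : ℝ × ℝ × ℝ | 0 < p.1 ∧ p.1 < p.2.1 ∧ p.2.1 < p.2.2 ∧ p.2.2 < 1},
        1 / ((1 - p.1) * p.2.1 * p.2.2) := by
  change _ = ∫ p in ztS, _
  rw [integral_eq_lintegral_of_nonneg_ae, ← lintegral_indicator ztS_meas]
  · simp_rw [zt_sum]
    rw [lintegral_tsum (fun n => (ztG_meas n).aemeasurable)]
    simp_rw [ztG_int]
    rw [ENNReal.tsum_toReal_eq (fun n => ENNReal.ofReal_ne_top)]
    refine tsum_congr fun n => ?_
    rw [ENNReal.toReal_ofReal (by positivity)]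
  · filter_upwards [ae_restrict_mem ztS_meas] with p h
    obtain ⟨h1, h2, h3, h4⟩ := h
    have hy : 0 < p.2.1 := h1.trans h2
    have hz : 0 < p.2.2 := hy.trans h3
    have hx : 0 < 1 - p.1 := sub_pos.2 (h2.trans (h3.trans h4))
    simp only [Pi.zero_apply]
    positivity
  · exact Measurable.aestronglyMeasurable (by fun_prop)
end

section
/- The function (x, y, z) ↦ 1/((1 − x)·y·z) is Lebesgue integrable on the open simplex {(x, y, z) ∈ ℝ³ : 0 < x < y < z < 1}; that is, the integral representing ζ(3) is absolutely convergent. -/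
open MeasureTheory

lemma zeta3_aux_int : IntegrableOn (fun t : ℝ => t ^ (-(2/3) : ℝ) * (1 - t) ^ (-(1/3) : ℝ))
    (Set.Ioo 0 1) volume := by
  have h := Complex.betaIntegral_convergent (u := ((1/3 : ℝ) : ℂ)) (v := ((2/3 : ℝ) : ℂ))
    (by rw [Complex.ofReal_re]; norm_num) (by rw [Complex.ofReal_re]; norm_num)
  rw [intervalIntegrable_iff_integrableOn_Ioo_of_le zero_le_one] at h
  refine IntegrableOn.congr_fun (Integrable.norm h) ?_ measurableSet_Ioo
  intro t ht
  have h1 : 0 < 1 - t := by linarith [ht.2]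
  have e1 : ((1/3 : ℝ) : ℂ) - 1 = ((-(2/3) : ℝ) : ℂ) := by push_cast; ring
  have e2 : ((2/3 : ℝ) : ℂ) - 1 = ((-(1/3) : ℝ) : ℂ) := by push_cast; ring
  have e3 : (1 : ℂ) - (t : ℂ) = ((1 - t : ℝ) : ℂ) := by push_cast; ring
  simp only [norm_mul]
  rw [e1, e2, e3, Complex.norm_cpow_eq_rpow_re_of_pos ht.1,
    Complex.norm_cpow_eq_rpow_re_of_pos h1, Complex.ofReal_re, Complex.ofReal_re]

lemma zeta3_aux_bound (x y z : ℝ) (hx : 0 < x) (hxy : x < y) (hyz : y < z) (hz : z < 1) :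
    1 / ((1 - x) * y * z) ≤ (x ^ (-(2/3) : ℝ) * (1 - x) ^ (-(1/3) : ℝ)) *
      ((y ^ (-(2/3) : ℝ) * (1 - y) ^ (-(1/3) : ℝ)) *
        (z ^ (-(2/3) : ℝ) * (1 - z) ^ (-(1/3) : ℝ))) := by
  have hy : 0 < y := by linarith
  have hz0 : 0 < z := by linarith
  have a1 : 0 < 1 - x := by linarith
  have a2 : 0 < 1 - y := by linarith
  have a3 : 0 < 1 - z := by linarith
  have k1 : (1 - x)⁻¹ ≤ (1 - x) ^ (-(1/3) : ℝ) * (1 - y) ^ (-(1/3) : ℝ)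
      * (1 - z) ^ (-(1/3) : ℝ) := by
    calc (1 - x)⁻¹ = (1 - x) ^ (-(1/3) : ℝ) * (1 - x) ^ (-(1/3) : ℝ)
          * (1 - x) ^ (-(1/3) : ℝ) := by
          rw [← Real.rpow_add a1, ← Real.rpow_add a1, ← Real.rpow_neg_one]; norm_num
      _ ≤ _ := by
          have b1 : (1 - x) ^ (-(1/3) : ℝ) ≤ (1 - y) ^ (-(1/3) : ℝ) :=
            Real.rpow_le_rpow_of_nonpos a2 (by linarith) (by norm_num)
          have b2 : (1 - x) ^ (-(1/3) : ℝ) ≤ (1 - z) ^ (-(1/3) : ℝ) :=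
            Real.rpow_le_rpow_of_nonpos a3 (by linarith) (by norm_num)
          exact mul_le_mul (mul_le_mul_of_nonneg_left b1 (by positivity)) b2
            (by positivity) (by positivity)
  have k2 : y⁻¹ * z⁻¹ ≤ x ^ (-(2/3) : ℝ) * y ^ (-(2/3) : ℝ) * z ^ (-(2/3) : ℝ) := by
    have c1 : y⁻¹ = y ^ (-(1/3) : ℝ) * y ^ (-(2/3) : ℝ) := by
      rw [← Real.rpow_add hy, ← Real.rpow_neg_one]; norm_num
    have c2 : z⁻¹ = z ^ (-(1/3) : ℝ) * z ^ (-(2/3) : ℝ) := by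
      rw [← Real.rpow_add hz0, ← Real.rpow_neg_one]; norm_num
    have c3 : x ^ (-(2/3) : ℝ) = x ^ (-(1/3) : ℝ) * x ^ (-(1/3) : ℝ) := by
      rw [← Real.rpow_add hx]; norm_num
    have b1 : y ^ (-(1/3) : ℝ) ≤ x ^ (-(1/3) : ℝ) :=
      Real.rpow_le_rpow_of_nonpos hx (by linarith) (by norm_num)
    have b2 : z ^ (-(1/3) : ℝ) ≤ x ^ (-(1/3) : ℝ) :=
      Real.rpow_le_rpow_of_nonpos hx (by linarith) (by norm_num)
    have b3 := mul_le_mul b1 b2 (by positivity) (by positivity)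
    rw [c1, c2, c3]
    calc _ = (y ^ (-(1/3) : ℝ) * z ^ (-(1/3) : ℝ)) *
          (y ^ (-(2/3) : ℝ) * z ^ (-(2/3) : ℝ)) := by ring
      _ ≤ (x ^ (-(1/3) : ℝ) * x ^ (-(1/3) : ℝ)) *
          (y ^ (-(2/3) : ℝ) * z ^ (-(2/3) : ℝ)) :=
          mul_le_mul_of_nonneg_right b3 (by positivity)
      _ = _ := by ring
  calc 1 / ((1 - x) * y * z) = (1 - x)⁻¹ * (y⁻¹ * z⁻¹) := by
        field_simp
    _ ≤ _ := mul_le_mul k1 k2 (by positivity) (by positivity)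
    _ = _ := by ring

/-- The function (x, y, z) ↦ 1/((1 − x)·y·z) is Lebesgue integrable on the open simplex
{(x, y, z) ∈ ℝ³ : 0 < x < y < z < 1}: the integral representing ζ(3) is absolutely
convergent. -/
theorem integrableOn_zeta_three_integrand :
    IntegrableOn (fun p : ℝ × ℝ × ℝ => 1 / ((1 - p.1) * p.2.1 * p.2.2))
      {p : ℝ × ℝ × ℝ | 0 < p.1 ∧ p.1 < p.2.1 ∧ p.2.1 < p.2.2 ∧ p.2.2 < 1} volume := by
  have hS : MeasurableSet
      {p : ℝ × ℝ × ℝ | 0 < p.1 ∧ p.1 < p.2.1 ∧ p.2.1 < p.2.2 ∧ p.2.2 < 1} := by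
    have m1 : MeasurableSet {p : ℝ × ℝ × ℝ | 0 < p.1} :=
      measurableSet_lt (by fun_prop) (by fun_prop)
    have m2 : MeasurableSet {p : ℝ × ℝ × ℝ | p.1 < p.2.1} :=
      measurableSet_lt (by fun_prop) (by fun_prop)
    have m3 : MeasurableSet {p : ℝ × ℝ × ℝ | p.2.1 < p.2.2} :=
      measurableSet_lt (by fun_prop) (by fun_prop)
    have m4 : MeasurableSet {p : ℝ × ℝ × ℝ | p.2.2 < 1} :=
      measurableSet_lt (by fun_prop) (by fun_prop)
    exact m1.inter (m2.inter (m3.inter m4))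
  have h := zeta3_aux_int
  have h3 := Integrable.mul_prod h (Integrable.mul_prod h h)
  rw [Measure.prod_restrict, Measure.prod_restrict] at h3
  have h4 := IntegrableOn.mono_set (s := {p : ℝ × ℝ × ℝ | 0 < p.1 ∧ p.1 < p.2.1 ∧ p.2.1 < p.2.2 ∧ p.2.2 < 1}) h3 (by
    rintro ⟨x, y, z⟩ ⟨h1, h2, h3, h4⟩
    simp only at h1 h2 h3 h4
    refine ⟨⟨h1, ?_⟩, ⟨?_, ?_⟩, ⟨?_, h4⟩⟩ <;> simp only <;> linarith)
  refine Integrable.mono' h4 (by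
    apply Measurable.aestronglyMeasurable
    fun_prop) ?_
  refine (ae_restrict_iff' hS).2 (Filter.Eventually.of_forall ?_)
  rintro ⟨x, y, z⟩ ⟨h1, h2, h3, h4⟩
  simp only at h1 h2 h3 h4
  have p1 : 0 < 1 - x := by linarith
  have p2 : 0 < y := by linarith
  have p3 : 0 < z := by linarith
  rw [Real.norm_of_nonneg (by positivity)]
  exact zeta3_aux_bound x y z h1 h2 h3 h4
end

section
/- The number ζ(3) = ∑_{n=1}^∞ 1/n³ is irrational (Apéry's theorem). -/
namespace Apery
open Finset

lemma log_eq_sum {p n b : ℕ} (hp : p.Prime) (hn : n ≠ 0) (hb : Nat.log p n < b) :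
    Nat.log p n = ∑ i ∈ Ico 1 b, if p ^ i ≤ n then 1 else 0 := by
  rw [← Finset.card_filter]
  have : (Ico 1 b).filter (fun i => p ^ i ≤ n) = Ico 1 (Nat.log p n + 1) := by
    ext i
    simp only [mem_filter, mem_Ico]
    rw [← Nat.le_log_iff_pow_le hp.one_lt hn]
    omega
  rw [this]; simp

lemma ptwise (m q : ℕ) (hq : 0 < q) :
    (if q ≤ 42 * m then 1 else 0) + (21 * m / q + 14 * m / q + 6 * m / q + m / q)
      ≤ 42 * m / q + (if q ≤ m then 1 else 0) := by
  have h1 : 21 * m / q = 42 * m / q / 2 := by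
    rw [Nat.div_div_eq_div_mul, mul_comm q 2, ← Nat.div_div_eq_div_mul]; congr 1; omega
  have h2 : 14 * m / q = 42 * m / q / 3 := by
    rw [Nat.div_div_eq_div_mul, mul_comm q 3, ← Nat.div_div_eq_div_mul]; congr 1; omega
  have h3 : 6 * m / q = 42 * m / q / 7 := by
    rw [Nat.div_div_eq_div_mul, mul_comm q 7, ← Nat.div_div_eq_div_mul]; congr 1; omega
  have h4 : m / q = 42 * m / q / 42 := by
    rw [Nat.div_div_eq_div_mul, mul_comm q 42, ← Nat.div_div_eq_div_mul]; congr 1; omega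
  have h5 : q ≤ 42 * m → 1 ≤ 42 * m / q := fun h => (Nat.one_le_div_iff hq).2 h
  have h6 : ¬ q ≤ m → m / q = 0 := fun h => Nat.div_eq_of_lt (by omega)
  rw [h4] at h6
  rw [h1, h2, h3, h4]
  generalize 42 * m / q = N at *
  split_ifs with a b b
  · omega
  · have := h5 a; have := h6 b; omega
  · omega
  · omega

lemma lcm_dvd (m : ℕ) (hm : m ≠ 0) :
    Nat.lcmUpto (42 * m) * ((21 * m).factorial * (14 * m).factorial * (6 * m).factorial * m.factorial)
      ∣ (42 * m).factorial * Nat.lcmUpto m := by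
  have f := Nat.factorial_ne_zero
  have g := Nat.lcmUpto_ne_zero
  rw [← Nat.factorization_prime_le_iff_dvd
    (by simp [f, g]) (by simp [f, g])]
  intro p hp
  rw [Nat.factorization_mul (g _) (by simp [f]), Nat.factorization_mul (by simp [f]) (f _),
    Nat.factorization_mul (by simp [f]) (f _), Nat.factorization_mul (f _) (f _),
    Nat.factorization_mul (f _) (g _)]
  simp only [Finsupp.add_apply, Nat.factorization_lcmUpto _ hp]
  set b := Nat.log p (42 * m) + 1 with hb
  have hl : ∀ k, k ≤ 42 * m → Nat.log p k < b := fun k hk =>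
    Nat.lt_succ_of_le (Nat.log_mono_right hk)
  rw [Nat.factorization_factorial hp (hl (21 * m) (by omega)),
    Nat.factorization_factorial hp (hl (14 * m) (by omega)),
    Nat.factorization_factorial hp (hl (6 * m) (by omega)),
    Nat.factorization_factorial hp (hl (m) (by omega)),
    Nat.factorization_factorial hp (hl (42 * m) (by omega)),
    log_eq_sum hp (by omega) (hl (42 * m) (by omega)), log_eq_sum hp hm (hl m (by omega))]
  simp only [← Finset.sum_add_distrib]
  exact Finset.sum_le_sum fun i _ => ptwise m (p ^ i) (pow_pos hp.pos i)

lemma choose_bound (x y a b : ℕ) : (a + b).choose a * x ^ a * y ^ b ≤ (x + y) ^ (a + b) := by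
  rw [add_pow]
  refine le_trans (le_of_eq ?_) (Finset.single_le_sum (f := fun m => x ^ m * y ^ (a + b - m) * ((a + b).choose m)) (fun _ _ => Nat.zero_le _) (mem_range.2 (by omega : a < a + b + 1)))
  simp; ring

lemma fact_bound (m : ℕ) : (42 * m).factorial ≤ (2 ^ 22 * 3 ^ 15 * 7 ^ 7) ^ m *
    ((21 * m).factorial * (14 * m).factorial * (6 * m).factorial * m.factorial) := by
  have e1 := Nat.add_choose_mul_factorial_mul_factorial (21 * m) (21 * m)
  have e2 := Nat.add_choose_mul_factorial_mul_factorial (7 * m) (14 * m)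
  have e3 := Nat.add_choose_mul_factorial_mul_factorial m (6 * m)
  have b1 := choose_bound 1 1 (21 * m) (21 * m)
  have b2 := choose_bound 2 1 (14 * m) (7 * m)
  have b3 := choose_bound 6 1 (6 * m) m
  rw [show 21 * m + 21 * m = 42 * m by ring] at e1 b1
  rw [show 7 * m + 14 * m = 21 * m by ring] at e2
  rw [show 14 * m + 7 * m = 21 * m by ring] at b2
  rw [show m + 6 * m = 7 * m by ring] at e3
  rw [show 6 * m + m = 7 * m by ring] at b3
  simp only [one_pow, mul_one] at b1 b2 b3
  norm_num only at b1 b2 b3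
  rw [← e1]
  nth_rewrite 1 [← e2]
  rw [← e3]
  generalize (42 * m).choose (21 * m) = A at *
  generalize (21 * m).choose (14 * m) = B at *
  generalize (7 * m).choose (6 * m) = C at *
  have key : A * B * C ≤ (2 ^ 22 * 3 ^ 15 * 7 ^ 7) ^ m := by
    have h : A * (B * 2 ^ (14 * m)) * (C * 6 ^ (6 * m)) ≤ 2 ^ (42 * m) * 3 ^ (21 * m) * 7 ^ (7 * m) :=
      Nat.mul_le_mul (Nat.mul_le_mul b1 b2) b3
    have h2 : 2 ^ (42 * m) * 3 ^ (21 * m) * 7 ^ (7 * m) = (2 ^ 22 * 3 ^ 15 * 7 ^ 7) ^ m * (2 ^ (14 * m) * 6 ^ (6 * m)) := by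
      simp only [pow_mul, ← mul_pow]; norm_num
    rw [h2] at h
    refine Nat.le_of_mul_le_mul_right (c := 2 ^ (14 * m) * 6 ^ (6 * m)) (le_trans (le_of_eq (by ring)) h) (by positivity)
  calc _ = A * B * C * ((21 * m).factorial * (14 * m).factorial * (6 * m).factorial * m.factorial) := by ring
    _ ≤ _ := Nat.mul_le_mul_right _ key

lemma lcm_step (m : ℕ) (hm : m ≠ 0) :
    Nat.lcmUpto (42 * m) ≤ (2 ^ 22 * 3 ^ 15 * 7 ^ 7) ^ m * Nat.lcmUpto m := by
  have h := Nat.le_of_dvd (Nat.mul_pos (Nat.factorial_pos _) (Nat.lcmUpto_pos _)) (lcm_dvd m hm)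
  have h2 := Nat.mul_le_mul_right (Nat.lcmUpto m) (fact_bound m)
  refine Nat.le_of_mul_le_mul_right (c := ((21 * m).factorial * (14 * m).factorial * (6 * m).factorial * m.factorial)) (h.trans (h2.trans (le_of_eq (by ring)))) (by positivity)

lemma lcm_mono_dvd {m n : ℕ} (h : m ≤ n) : Nat.lcmUpto m ∣ Nat.lcmUpto n := by
  unfold Nat.lcmUpto
  exact Finset.lcm_mono (Finset.Icc_subset_Icc_right h)

lemma lcm_bound : ∃ K : ℝ, 0 < K ∧ ∀ n, (Nat.lcmUpto n : ℝ) ≤ K * (16 / 5) ^ n := by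
  have mono : ∀ {m n : ℕ}, m ≤ n → Nat.lcmUpto m ≤ Nat.lcmUpto n := fun h =>
    Nat.le_of_dvd (Nat.lcmUpto_pos _) (lcm_mono_dvd h)
  obtain ⟨K, hK⟩ : ∃ K, K = Nat.lcmUpto 2000 := ⟨_, rfl⟩
  have hK0 : 0 < K := hK ▸ Nat.lcmUpto_pos _
  refine ⟨K, by exact_mod_cast hK0, fun n => ?_⟩
  induction n using Nat.strong_induction_on with
  | _ n ih =>
  rcases le_or_gt n 2000 with h | h
  · have h1 : (Nat.lcmUpto n : ℝ) ≤ K := by rw [hK]; exact_mod_cast mono h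
    have h2 : (1 : ℝ) ≤ (16 / 5) ^ n := one_le_pow₀ (by norm_num)
    have h3 : (0 : ℝ) ≤ K := by positivity
    exact h1.trans (le_mul_of_one_le_right h3 h2)
  · obtain ⟨j, hj⟩ : ∃ j, n / 42 = j + 30 := ⟨n / 42 - 30, by omega⟩
    have h1 : (Nat.lcmUpto n : ℝ) ≤ (2 ^ 22 * 3 ^ 15 * 7 ^ 7) ^ (j + 31) * Nat.lcmUpto (j + 31) := by
      exact_mod_cast (mono (show n ≤ 42 * (j + 31) by omega)).trans (lcm_step (j + 31) (by omega))
    have h2 := ih (j + 31) (by omega)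
    have h3 : ((2 ^ 22 * 3 ^ 15 * 7 ^ 7 : ℝ) * (16 / 5)) ^ (j + 31) ≤ (16 / 5) ^ n := by
      calc ((2 ^ 22 * 3 ^ 15 * 7 ^ 7 : ℝ) * (16 / 5)) ^ (j + 31) ≤ ((16 / 5) ^ 42) ^ (j + 30) := by
            rw [pow_add, pow_add]
            apply mul_le_mul
            · exact pow_le_pow_left₀ (by norm_num) (by norm_num) _
            · norm_num
            · positivity
            · positivity
        _ = (16 / 5) ^ (42 * (j + 30)) := by rw [pow_mul]
        _ ≤ _ := pow_le_pow_right₀ (by norm_num) (by omega)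
    calc (Nat.lcmUpto n : ℝ) ≤ _ := h1
      _ ≤ (2 ^ 22 * 3 ^ 15 * 7 ^ 7) ^ (j + 31) * (K * (16 / 5) ^ (j + 31)) := by gcongr
      _ = K * ((2 ^ 22 * 3 ^ 15 * 7 ^ 7 : ℝ) * (16 / 5)) ^ (j + 31) := by
        rw [mul_pow _ (16 / 5 : ℝ)]; generalize (2 ^ 22 * 3 ^ 15 * 7 ^ 7 : ℝ) ^ (j + 31) = X; ring
      _ ≤ _ := by gcongr


noncomputable def lam (n k : ℕ) : ℝ := (n.choose k : ℝ) * ((n + k).choose k : ℝ)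

lemma R1 (n k : ℕ) : ((n : ℝ) + 1 - k) * lam (n + 1) k = (n + 1 + k) * lam n k := by
  unfold lam
  have h2 : ((n + 1 + k).choose k : ℝ) * (n + 1) = ((n + k).choose k : ℝ) * (n + k + 1) := by
    have := Nat.choose_mul_succ_eq (n + k) k
    rw [show n + k + 1 - k = n + 1 by omega, show n + k + 1 = n + 1 + k by omega] at this
    have h : (((n + k).choose k * (n + 1 + k) : ℕ) : ℝ) = ((n + 1 + k).choose k * (n + 1) : ℕ) := by
      rw [this]
    push_cast at h; linarith
  have h1 : (n.choose k : ℝ) * (n + 1) = ((n + 1).choose k : ℝ) * (n + 1 - k) := by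
    rcases le_or_gt k (n + 1) with hk | hk
    · have h : ((n.choose k * (n + 1) : ℕ) : ℝ) = ((n + 1).choose k * (n + 1 - k) : ℕ) := by
        rw [Nat.choose_mul_succ_eq n k]
      push_cast [Nat.cast_sub hk] at h; exact h
    · rw [Nat.choose_eq_zero_of_lt hk, Nat.choose_eq_zero_of_lt (by omega : n < k)]; simp
  have hn : (n : ℝ) + 1 ≠ 0 := by positivity
  apply mul_right_cancel₀ hn
  linear_combination (-((n + 1 + k).choose k : ℝ) * (n + 1)) * h1 + ((n.choose k : ℝ) * (n + 1)) * h2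

lemma R2 (n k : ℕ) : ((k : ℝ) + 1) ^ 2 * lam n (k + 1) = (n - k) * (n + k + 1) * lam n k := by
  unfold lam
  have h1 : (n.choose (k + 1) : ℝ) * (k + 1) = n.choose k * (n - k) := by
    rcases le_or_gt k n with hk | hk
    · have h : ((n.choose (k + 1) * (k + 1) : ℕ) : ℝ) = (n.choose k * (n - k) : ℕ) := by
        rw [Nat.choose_succ_right_eq]
      push_cast [Nat.cast_sub hk] at h; exact h
    · rw [Nat.choose_eq_zero_of_lt hk, Nat.choose_eq_zero_of_lt (by omega : n < k + 1)]; simp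
  have h2 : ((n + (k + 1)).choose (k + 1) : ℝ) * (k + 1) = (n + k + 1) * (n + k).choose k := by
    have h : (((n + k + 1) * (n + k).choose k : ℕ) : ℝ) = ((n + k + 1).choose (k + 1) * (k + 1) : ℕ) := by
      rw [Nat.add_one_mul_choose_eq]
    push_cast at h; rw [← add_assoc]; linarith
  linear_combination ((n + (k + 1)).choose (k + 1) : ℝ) * (k + 1) * h1 + (n.choose k : ℝ) * (n - k) * h2

lemma lam_zero (n : ℕ) : lam n 0 = 1 := by simp [lam]
lemma lam_pos {n k : ℕ} (h : k ≤ n) : 0 < lam n k := by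
  unfold lam
  have := Nat.choose_pos h
  have := Nat.choose_pos (show k ≤ n + k by omega)
  positivity
lemma lam_nonneg (n k : ℕ) : 0 ≤ lam n k := by unfold lam; positivity
lemma lam_gt {n k : ℕ} (h : n < k) : lam n k = 0 := by
  simp [lam, Nat.choose_eq_zero_of_lt h]

noncomputable def G (n k : ℕ) : ℝ := lam (n + 2) k / ((n + 1 + k) * (n + 2 + k))

lemma G2 (n k : ℕ) : lam (n + 2) k = G n k * (n + 1 + k) * (n + 2 + k) := by
  unfold G
  have : (n : ℝ) + 1 + k ≠ 0 := by positivity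
  have : (n : ℝ) + 2 + k ≠ 0 := by positivity
  field_simp
lemma G1 (n k : ℕ) : lam (n + 1) k = G n k * (n + 1 + k) * (n + 2 - k) := by
  have h := R1 (n + 1) k
  push_cast at h
  rw [show n + 1 + 1 = n + 2 by rfl, G2] at h
  have : (n : ℝ) + 2 + k ≠ 0 := by positivity
  apply mul_left_cancel₀ this
  linear_combination -h
lemma G0 (n k : ℕ) : lam n k = G n k * (n + 1 - k) * (n + 2 - k) := by
  have h := R1 n k
  rw [G1] at h
  have : (n : ℝ) + 1 + k ≠ 0 := by positivity
  apply mul_left_cancel₀ this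
  linear_combination -h
lemma Gs (n k : ℕ) : G n (k + 1) = G n k * (n + k + 1) * (n + 2 - k) / (k + 1) ^ 2 := by
  have h := R2 (n + 2) k
  rw [G2, G2] at h
  have : (n : ℝ) + 2 + k ≠ 0 := by positivity
  have h3 : (n : ℝ) + 3 + k ≠ 0 := by positivity
  have : (k : ℝ) + 1 ≠ 0 := by positivity
  rw [eq_div_iff (by positivity)]
  push_cast at h
  apply mul_left_cancel₀ (mul_ne_zero (by assumption : (n : ℝ) + 2 + k ≠ 0) h3)
  linear_combination h

noncomputable def P (x : ℝ) : ℝ := (2 * x + 1) * (17 * x ^ 2 + 17 * x + 5)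
noncomputable def B (n k : ℕ) : ℝ :=
  4 * (2 * n + 3) * (k * (2 * k + 1) - (2 * n + 3) ^ 2) * lam (n + 1) k ^ 2

lemma a_tele (n K : ℕ) : ∑ k ∈ range (K + 1), (((n : ℝ) + 2) ^ 3 * lam (n + 2) k ^ 2
    - P (n + 1) * lam (n + 1) k ^ 2 + (n + 1) ^ 3 * lam n k ^ 2) = B n K := by
  induction K with
  | zero => simp [lam_zero, B, P]; ring
  | succ k ih =>
    rw [Finset.sum_range_succ, ih]
    unfold B P
    rw [G2, G1 n k, G1 n (k + 1), G0 n (k + 1), Gs]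
    have : (k : ℝ) + 1 ≠ 0 := by positivity
    push_cast
    field_simp
    ring

noncomputable def a (n : ℕ) : ℝ := ∑ k ∈ range (n + 1), lam n k ^ 2

lemma sum_ext (f : ℕ → ℝ) (n m : ℕ) (h : n ≤ m) :
    ∑ k ∈ range (n + 1), lam n k ^ 2 * f k = ∑ k ∈ range (m + 1), lam n k ^ 2 * f k := by
  apply Finset.sum_subset
  · intro x; simp; omega
  · intro x _ hx
    rw [lam_gt (by simpa using hx)]; simp

lemma a_rec (n : ℕ) : ((n : ℝ) + 2) ^ 3 * a (n + 2) - P (n + 1) * a (n + 1) + (n + 1) ^ 3 * a n = 0 := by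
  have h := a_tele n (n + 2)
  rw [B, lam_gt (by omega : n + 1 < n + 2)] at h
  have e0 := sum_ext (fun _ => 1) n (n + 2) (by omega)
  have e1 := sum_ext (fun _ => 1) (n + 1) (n + 2) (by omega)
  simp only [mul_one] at e0 e1
  rw [a, a, a, e0, e1, Finset.mul_sum, Finset.mul_sum, Finset.mul_sum, ← Finset.sum_sub_distrib,
    ← Finset.sum_add_distrib, h]
  simp

noncomputable def c (n k : ℕ) : ℝ := ∑ m ∈ range n, 1 / ((m : ℝ) + 1) ^ 3 +
  ∑ m ∈ range k, (-1) ^ m / (2 * ((m : ℝ) + 1) ^ 3 * lam n (m + 1))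

lemma c_succ (n k : ℕ) : c n (k + 1) = c n k + (-1) ^ k / (2 * ((k : ℝ) + 1) ^ 3 * lam n (k + 1)) := by
  unfold c; rw [Finset.sum_range_succ]; ring

lemma c_delta (n k : ℕ) (hk : k ≤ n) :
    c (n + 1) k = c n k + (-1) ^ k / (((n : ℝ) + 1) ^ 2 * (n + 1 + k) * lam n k) := by
  induction k with
  | zero => 
    simp [c, Finset.sum_range_succ, lam_zero]
    rw [← mul_inv]; congr 1; ring
  | succ k ih =>
    rw [c_succ, c_succ, ih (by omega)]
    obtain ⟨j, rfl⟩ : ∃ j, n = k + 1 + j := ⟨n - (k + 1), by omega⟩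
    have hL := lam_pos (show k ≤ k + 1 + j by omega)
    have h1 := R2 (k + 1 + j) k
    have h2 := R1 (k + 1 + j) (k + 1)
    set L := lam (k + 1 + j) k
    push_cast at *
    have h3 : lam (k + 1 + j) (k + 1) = (j + 1) * (2 * k + j + 2) * L / (k + 1) ^ 2 := by
      rw [eq_div_iff (by positivity)]; linear_combination h1
    have h4 : lam (k + 1 + j + 1) (k + 1) = (2 * k + j + 3) * (2 * k + j + 2) * L / (k + 1) ^ 2 := by
      rw [h3] at h2
      have : (j : ℝ) + 1 ≠ 0 := by positivity
      apply mul_left_cancel₀ this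
      linear_combination h2
    rw [h3, h4, pow_succ]
    have : (k : ℝ) + 1 + j + 1 + k ≠ 0 := by positivity
    have : (k : ℝ) + 1 + j + 1 + (k + 1) ≠ 0 := by positivity
    have : (k : ℝ) + 1 + j + 1  ≠ 0 := by positivity
    field_simp
    ring

noncomputable def E (n k : ℕ) : ℝ :=
  -(5 * (2 * n + 3) * (-1) ^ k * k / ((n + 1) * (n + 2)) * lam (n + 1) k)

lemma d0 (n k : ℕ) : lam n k ^ 2 * c n k =
    lam n k ^ 2 * c (n + 1) k - (-1) ^ k * lam n k / (((n : ℝ) + 1) ^ 2 * (n + 1 + k)) := by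
  rcases le_or_gt k n with h | h
  · rw [c_delta n k h]
    have := lam_pos h
    have : (n : ℝ) + 1 + k ≠ 0 := by positivity
    field_simp
    ring
  · rw [lam_gt h]; simp

lemma d2 (n k : ℕ) (h : k ≤ n) : lam (n + 1) k ^ 2 * c (n + 1) k =
    lam (n + 1) k ^ 2 * c n k + (-1) ^ k * lam (n + 1) k / (((n : ℝ) + 1) ^ 2 * (n + 1 - k)) := by
  rw [c_delta n k h]
  have hl := lam_pos h
  have h1 : (n : ℝ) + 1 + k ≠ 0 := by positivity
  have h2 : (n : ℝ) + 1 - k ≠ 0 := by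
    have : (k : ℝ) ≤ n := by exact_mod_cast h
    linarith
  have h3 : lam (n + 1) k = (n + 1 + k) * lam n k / (n + 1 - k) := by
    rw [eq_div_iff h2, ← R1]; ring
  rw [h3]
  field_simp

set_option maxRecDepth 20000 in
set_option maxHeartbeats 1000000 in
lemma b_tele (n K : ℕ) (hK : K ≤ n + 1) : ∑ k ∈ range (K + 1),
    (((n : ℝ) + 2) ^ 3 * (lam (n + 2) k ^ 2 * c (n + 2) k)
    - P (n + 1) * (lam (n + 1) k ^ 2 * c (n + 1) k) + (n + 1) ^ 3 * (lam n k ^ 2 * c n k))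
    = B n K * c (n + 1) K + E n K := by
  induction K with
  | zero =>
    simp only [zero_add, Finset.sum_range_one]
    have hd := d2 (n + 1) 0 (by omega)
    rw [show n + 1 + 1 = n + 2 by rfl] at hd
    rw [d0 n 0, hd]
    simp only [lam_zero, B, P, E]
    push_cast
    have : (n : ℝ) + 1 + 1 ≠ 0 := by positivity
    field_simp
    ring
  | succ k ih =>
    have hd := d2 (n + 1) (k + 1) hK
    rw [show n + 1 + 1 = n + 2 by rfl] at hd
    rw [Finset.sum_range_succ, ih (by omega), d0 n (k + 1), hd]
    have hc := c_succ (n + 1) k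
    have hc' : c (n + 1) k = c (n + 1) (k + 1) - (-1) ^ k / (2 * ((k : ℝ) + 1) ^ 3 * lam (n + 1) (k + 1)) := by
      rw [hc]; ring
    rw [hc']
    generalize c (n + 1) (k + 1) = C
    have hg : 0 < lam (n + 1) k := lam_pos (by omega)
    unfold B E P
    rw [G2, G1 n k, G1 n (k + 1), G0 n (k + 1), Gs]
    rw [G1] at hg
    obtain ⟨j, rfl⟩ : ∃ j, n = k + j := ⟨n - k, by omega⟩
    generalize G (k + j) k = g at *
    have hg0 : g ≠ 0 := by rintro rfl; simp at hg
    rw [pow_succ (-1 : ℝ) k]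
    generalize hs : (-1 : ℝ) ^ k = s
    push_cast
    rw [show (k : ℝ) + j + 1 + 1 - (k + 1) = j + 1 by ring, show (k : ℝ) + j + 2 - k = j + 2 by ring,
      show (k : ℝ) + j + 2 - (k + 1) = j + 1 by ring, show (k : ℝ) + j + 1 - (k + 1) = j by ring]
    have : (k : ℝ) + j + 1 + 1 ≠ 0 := by positivity
    have : (k : ℝ) + j + k + 1 ≠ 0 := by positivity
    have : (k : ℝ) + j + 1 + k ≠ 0 := by positivity
    have : (k : ℝ) + j + 1 + (k + 1) ≠ 0 := by positivity
    field_simp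
    ring

noncomputable def b (n : ℕ) : ℝ := ∑ k ∈ range (n + 1), lam n k ^ 2 * c n k

lemma b_rec (n : ℕ) : ((n : ℝ) + 2) ^ 3 * b (n + 2) - P (n + 1) * b (n + 1) + (n + 1) ^ 3 * b n = 0 := by
  have h := b_tele n (n + 1) le_rfl
  have e0 := sum_ext (c n) n (n + 2) (by omega)
  have e1 := sum_ext (c (n + 1)) (n + 1) (n + 2) (by omega)
  rw [b, b, b, e0, e1, Finset.mul_sum, Finset.mul_sum, Finset.mul_sum, ← Finset.sum_sub_distrib,
    ← Finset.sum_add_distrib, Finset.sum_range_succ, h, lam_gt (by omega : n + 1 < n + 2),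
    lam_gt (by omega : n < n + 2), c_succ (n + 2) (n + 1), c_delta (n + 1) (n + 1) le_rfl]
  generalize c (n + 1) (n + 1) = C
  have hg : 0 < lam (n + 1) (n + 1) := lam_pos le_rfl
  unfold B E
  have h2 := G2 n (n + 1 + 1)
  rw [Gs] at h2
  rw [show lam (n + 2) (n + 2) = lam (n + 2) (n + 1 + 1) by rfl, h2]
  rw [G1] at *
  generalize G n (n + 1) = g at *
  have hg0 : g ≠ 0 := by rintro rfl; simp at hg
  push_cast
  generalize hs : (-1 : ℝ) ^ (n + 1) = s
  rw [show (n : ℝ) + 2 - (n + 1) = 1 by ring]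
  have : (n : ℝ) + 1 + 1 ≠ 0 := by positivity
  have : (n : ℝ) + 1 + (n + 1) ≠ 0 := by positivity
  have : (n : ℝ) + (n + 1) + 1 ≠ 0 := by positivity
  have : (n : ℝ) + 1 + (n + 1 + 1) ≠ 0 := by positivity
  have : (n : ℝ) + 2 + (n + 1 + 1) ≠ 0 := by positivity
  have : (n : ℝ) + 1 + 1 + (n + 1) ≠ 0 := by positivity
  field_simp
  ring

lemma a0 : a 0 = 1 := by simp [a, lam]
lemma a1 : a 1 = 5 := by simp [a, lam, Finset.sum_range_succ]; norm_num
lemma b0 : b 0 = 0 := by simp [b, lam, c]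
lemma b1 : b 1 = 6 := by simp [b, lam, c, Finset.sum_range_succ]; norm_num

lemma casorati (n : ℕ) : b (n + 1) * a n - a (n + 1) * b n = 6 / ((n : ℝ) + 1) ^ 3 := by
  induction n with
  | zero => simp [a0, a1, b0, b1]
  | succ n ih =>
    have h1 := a_rec n
    have h2 := b_rec n
    push_cast
    rw [eq_div_iff (by positivity)] at ih ⊢
    rw [show n + 1 + 1 = n + 2 by rfl]
    linear_combination ih + a (n + 1) * h2 - b (n + 1) * h1

lemma a_pos (n : ℕ) : 0 < a n := by
  unfold a
  apply Finset.sum_pos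
  · intro k hk
    have := lam_pos (show k ≤ n by simp at hk; omega)
    positivity
  · simp

lemma a_mono (n : ℕ) : a n ≤ a (n + 1) := by
  have e0 := sum_ext (fun _ => 1) n (n + 1) (by omega)
  simp only [mul_one] at e0
  rw [a, a, e0]
  apply Finset.sum_le_sum
  intro k hk
  apply pow_le_pow_left₀ (lam_nonneg _ _)
  unfold lam
  have h1 : n.choose k ≤ (n + 1).choose k := Nat.choose_le_choose k (by omega)
  have h2 : (n + k).choose k ≤ (n + 1 + k).choose k := Nat.choose_le_choose k (by omega)
  gcongr

/-- eventual ratio bound -/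
lemma a_ratio1 (n : ℕ) (hn : 100 ≤ n) : 32 * a (n + 1) ≤ a (n + 2) := by
  have h := a_rec n
  have hm := a_mono n
  have hp := a_pos (n + 1)
  have hn' : (100 : ℝ) ≤ n := by exact_mod_cast hn
  have h3 : ((n : ℝ) + 1) ^ 3 * a n ≤ ((n : ℝ) + 1) ^ 3 * a (n + 1) := by gcongr
  have h4 : 32 * ((n : ℝ) + 2) ^ 3 + (n + 1) ^ 3 ≤ P (n + 1) := by
    unfold P
    obtain ⟨t, ht⟩ : ∃ t : ℝ, (n : ℝ) = 100 + t := ⟨n - 100, by ring⟩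
    have : 0 ≤ t := by linarith
    rw [ht, ← sub_nonneg]; ring_nf; positivity
  have h5 := mul_le_mul_of_nonneg_right h4 hp.le
  have : (0 : ℝ) < ((n : ℝ) + 2) ^ 3 := by positivity
  apply le_of_mul_le_mul_left _ this
  linarith

lemma a_ratio (n : ℕ) (hn : 101 ≤ n) : 33 * a (n + 1) ≤ a (n + 2) := by
  have h := a_rec n
  have hm : 32 * a n ≤ a (n + 1) := by
    obtain ⟨m, rfl⟩ : ∃ m, n = m + 1 := ⟨n - 1, by omega⟩
    exact a_ratio1 m (by omega)
  have hp := a_pos (n + 1)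
  have hn' : (101 : ℝ) ≤ n := by exact_mod_cast hn
  have h3 : ((n : ℝ) + 1) ^ 3 * a n ≤ ((n : ℝ) + 1) ^ 3 * (a (n + 1) / 32) := by gcongr; linarith
  have h4 : 33 * ((n : ℝ) + 2) ^ 3 + (n + 1) ^ 3 / 32 ≤ P (n + 1) := by
    unfold P
    obtain ⟨t, ht⟩ : ∃ t : ℝ, (n : ℝ) = 101 + t := ⟨n - 101, by ring⟩
    have : 0 ≤ t := by linarith
    rw [ht, ← sub_nonneg]; ring_nf; positivity
  have h5 := mul_le_mul_of_nonneg_right h4 hp.le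
  have : (0 : ℝ) < ((n : ℝ) + 2) ^ 3 := by positivity
  apply le_of_mul_le_mul_left _ this
  linarith

lemma a_growth (j : ℕ) : 33 ^ j ≤ a (102 + j) := by
  induction j with
  | zero =>
    have : ∀ n, 1 ≤ a n := fun n => by
      induction n with
      | zero => rw [a0]
      | succ n ih => exact ih.trans (a_mono n)
    simpa using this 102
  | succ j ih =>
    have := a_ratio (101 + j) (by omega)
    rw [show 101 + j + 1 = 102 + j by ring, show 101 + j + 2 = 102 + (j + 1) by ring] at this
    rw [pow_succ]; linarith

/-- The integers inside the reals. -/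
noncomputable def S : Subring ℝ := (Int.castRingHom ℝ).range

lemma nat_mem (n : ℕ) : (n : ℝ) ∈ S := natCast_mem S n

lemma dvd_mem {m n : ℕ} (h : m ∣ n) : (n : ℝ) / m ∈ S := by
  rcases Nat.eq_zero_or_pos m with rfl | hm
  · simp [S.zero_mem]
  · obtain ⟨t, rfl⟩ := h
    have : (m : ℝ) ≠ 0 := by positivity
    rw [Nat.cast_mul, mul_div_cancel_left₀ _ this]; exact nat_mem t

lemma dvd_lcmUpto' {m n : ℕ} (h1 : 1 ≤ m) (h : m ≤ n) : m ∣ Nat.lcmUpto n := by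
  unfold Nat.lcmUpto
  exact Finset.dvd_lcm (f := id) (by simp; omega)

lemma leibniz (m : ℕ) : ∀ n, m + 1 ≤ n →
    (Nat.lcmUpto n : ℝ) / (((m : ℝ) + 1) * n.choose (m + 1)) ∈ S := by
  induction m with
  | zero =>
    intro n hn
    have := dvd_mem (dvd_lcmUpto' hn le_rfl)
    simpa using this
  | succ m ih =>
    intro n hn
    obtain ⟨n, rfl⟩ : ∃ t, n = t + 1 := ⟨n - 1, by omega⟩
    have h1 := ih n (by omega)
    have h2 := ih (n + 1) (by omega)
    have h3 := S.mul_mem h1 (dvd_mem (lcm_mono_dvd (show n ≤ n + 1 by omega)))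
    have h4 := S.sub_mem h3 h2
    convert h4 using 1
    have e1 : ((n + 1).choose (m + 1 + 1) : ℝ) * (m + 1 + 1) = (n + 1).choose (m + 1) * (n - m) := by
      have h : (((n + 1).choose (m + 1 + 1) * (m + 1 + 1) : ℕ) : ℝ)
          = ((n + 1).choose (m + 1) * (n + 1 - (m + 1)) : ℕ) := by
        rw [Nat.choose_succ_right_eq]
      push_cast [Nat.cast_sub (show m ≤ n by omega), Nat.add_sub_add_right] at h
      rw [h]
    have e2 : (n.choose (m + 1) : ℝ) * (n + 1) = (n + 1).choose (m + 1) * (n - m) := by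
      have h : ((n.choose (m + 1) * (n + 1) : ℕ) : ℝ)
          = ((n + 1).choose (m + 1) * (n + 1 - (m + 1)) : ℕ) := by
        rw [Nat.choose_mul_succ_eq]
      push_cast [Nat.cast_sub (show m ≤ n by omega), Nat.add_sub_add_right] at h
      rw [h]
    have p1 : (0 : ℝ) < (n + 1).choose (m + 1 + 1) := by
      exact_mod_cast Nat.choose_pos (by omega)
    have p2 : (0 : ℝ) < (n + 1).choose (m + 1) := by
      exact_mod_cast Nat.choose_pos (by omega)
    have p3 : (0 : ℝ) < n.choose (m + 1) := by
      exact_mod_cast Nat.choose_pos (by omega)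
    have p4 : (0 : ℝ) < Nat.lcmUpto n := by exact_mod_cast Nat.lcmUpto_pos n
    have p5 : (n : ℝ) - m ≠ 0 := by
      have : (m : ℝ) + 2 ≤ n + 1 := by exact_mod_cast hn
      intro h; linarith
    have p6 : (n : ℝ) + 1 ≠ 0 := by positivity
    have e1' : ((n + 1).choose (m + 1 + 1) : ℝ) = (n + 1).choose (m + 1) * (n - m) / (m + 1 + 1) := by
      rw [eq_div_iff (by positivity), e1]
    have e2' : (n.choose (m + 1) : ℝ) = (n + 1).choose (m + 1) * (n - m) / (n + 1) := by
      rw [eq_div_iff (by positivity), e2]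
    push_cast
    rw [e1', e2']
    field_simp
    ring

lemma lam_mem (n k : ℕ) : lam n k ∈ S := S.mul_mem (nat_mem _) (nat_mem _)

lemma a_mem (n : ℕ) : a n ∈ S := S.sum_mem fun k _ => S.pow_mem (lam_mem n k) 2

lemma term_mem (n k m : ℕ) (hm : m + 1 ≤ k) (hk : k ≤ n) :
    (Nat.lcmUpto n : ℝ) ^ 3 * lam n k / (((m : ℝ) + 1) ^ 3 * lam n (m + 1)) ∈ S := by
  have i1 := leibniz m n (by omega)
  have i2 := leibniz m k hm
  have i3 := dvd_mem (lcm_mono_dvd hk)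
  have i4 := dvd_mem (dvd_lcmUpto' (show 1 ≤ m + 1 by omega) (show m + 1 ≤ n by omega))
  have i5 := S.mul_mem (S.mul_mem (S.mul_mem i1 i2) (S.mul_mem i3 i4))
    (S.mul_mem (nat_mem (n.choose k)) (nat_mem ((n + k).choose (k - (m + 1)))))
  convert i5 using 1
  have e : ((n + k).choose k : ℝ) * k.choose (m + 1)
      = (n + k).choose (k - (m + 1)) * (n + (m + 1)).choose (m + 1) := by
    have h := Nat.choose_mul (n := n + k) (k := k) (s := k - (m + 1)) (by omega)
    rw [Nat.choose_symm hm, show n + k - (k - (m + 1)) = n + (m + 1) by omega,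
      show k - (k - (m + 1)) = m + 1 by omega] at h
    exact_mod_cast h
  have p1 : (0 : ℝ) < n.choose (m + 1) := by exact_mod_cast Nat.choose_pos (by omega)
  have p2 : (0 : ℝ) < k.choose (m + 1) := by exact_mod_cast Nat.choose_pos (by omega)
  have p3 : (0 : ℝ) < (n + (m + 1)).choose (m + 1) := by exact_mod_cast Nat.choose_pos (by omega)
  have p4 : (0 : ℝ) < Nat.lcmUpto k := by exact_mod_cast Nat.lcmUpto_pos k
  have e' : ((n + k).choose k : ℝ)
      = (n + k).choose (k - (m + 1)) * (n + (m + 1)).choose (m + 1) / k.choose (m + 1) := by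
    rw [eq_div_iff p2.ne', e]
  unfold lam
  rw [e']
  push_cast
  field_simp

lemma b_mem (n : ℕ) : 2 * (Nat.lcmUpto n : ℝ) ^ 3 * b n ∈ S := by
  unfold b
  rw [Finset.mul_sum]
  refine S.sum_mem fun k hk => ?_
  have hk : k ≤ n := by simp at hk; omega
  unfold c
  rw [mul_add, mul_add, Finset.mul_sum, Finset.mul_sum, Finset.mul_sum, Finset.mul_sum]
  refine S.add_mem (S.sum_mem fun m hm => ?_) (S.sum_mem fun m hm => ?_)
  · have i4 := dvd_mem (dvd_lcmUpto' (show 1 ≤ m + 1 by omega) (show m + 1 ≤ n by simp at hm; omega))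
    have := S.mul_mem (S.mul_mem (nat_mem 2) (S.pow_mem i4 3)) (S.pow_mem (lam_mem n k) 2)
    convert this using 1
    push_cast
    field_simp
  · have hm : m + 1 ≤ k := by simp at hm; omega
    have := S.mul_mem (S.mul_mem (S.pow_mem (S.neg_mem S.one_mem) m) (lam_mem n k)) (term_mem n k m hm hk)
    convert this using 1
    have := lam_pos (show m + 1 ≤ n by omega)
    field_simp

lemma one_le_of_mem {x : ℝ} (h : x ∈ S) (hx : 0 < x) : 1 ≤ x := by
  obtain ⟨z, rfl⟩ := h
  simp only [eq_intCast] at *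
  have : 0 < z := by exact_mod_cast hx
  exact_mod_cast this

noncomputable def Z : ℝ := ∑' n : ℕ, 1 / ((n : ℝ) + 1) ^ 3

lemma Z_summable : Summable (fun n : ℕ => 1 / ((n : ℝ) + 1) ^ 3) := by
  have := (summable_nat_add_iff 1).2 (Real.summable_one_div_nat_pow.2 (show 1 < 3 by norm_num))
  simpa using this

lemma H_le (k : ℕ) : ∑ m ∈ range k, 1 / ((m : ℝ) + 1) ^ 3 ≤ Z :=
  Z_summable.sum_le_tsum _ (fun _ _ => by positivity)

lemma c_close (n k : ℕ) (hk : k ≤ n) :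
    |c n k - ∑ m ∈ range n, 1 / ((m : ℝ) + 1) ^ 3| ≤ Z / (n + 1) := by
  unfold c
  rw [add_sub_cancel_left]
  refine (Finset.abs_sum_le_sum_abs _ _).trans ?_
  rw [div_eq_mul_inv]
  refine le_trans ?_ (mul_le_mul_of_nonneg_right (H_le k) (by positivity))
  rw [Finset.sum_mul]
  refine Finset.sum_le_sum fun m hm => ?_
  have hm : m + 1 ≤ k := by simp at hm; omega
  have hl : (n : ℝ) + 1 ≤ lam n (m + 1) := by
    have h1 : 1 ≤ n.choose (m + 1) := Nat.choose_pos (by omega)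
    have h2 : n + 1 ≤ (n + (m + 1)).choose (m + 1) := by
      have h3 : (n + 1).choose n ≤ (n + (m + 1)).choose n := Nat.choose_le_choose n (by omega)
      have h4 : (n + (m + 1)).choose n = (n + (m + 1)).choose (m + 1) := Nat.choose_symm_add
      rw [← h4]
      simpa using h3
    have h3 : n + 1 ≤ n.choose (m + 1) * (n + (m + 1)).choose (m + 1) := by nlinarith
    unfold lam
    exact_mod_cast h3
  have hp : 0 < lam n (m + 1) := lt_of_lt_of_le (by positivity) hl
  rw [abs_div, abs_pow, abs_neg, abs_one, one_pow, abs_of_pos (by positivity), ← one_div,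
    div_mul_div_comm, one_mul]
  apply one_div_le_one_div_of_le (by positivity)
  have : (0 : ℝ) < ((m : ℝ) + 1) ^ 3 := by positivity
  nlinarith [mul_le_mul_of_nonneg_left hl this.le, mul_pos this hp]

lemma x_close (n : ℕ) : |b n / a n - ∑ m ∈ range n, 1 / ((m : ℝ) + 1) ^ 3| ≤ Z / (n + 1) := by
  set H := ∑ m ∈ range n, 1 / ((m : ℝ) + 1) ^ 3 with hH
  have ha := a_pos n
  have e : b n / a n - H = (∑ k ∈ range (n + 1), lam n k ^ 2 * (c n k - H)) / a n := by
    simp only [mul_sub]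
    rw [Finset.sum_sub_distrib, ← Finset.sum_mul, ← a, ← b]
    field_simp
  rw [e, abs_div, abs_of_pos ha, div_le_iff₀ ha]
  refine (Finset.abs_sum_le_sum_abs _ _).trans ?_
  rw [mul_comm, a, Finset.sum_mul]
  refine Finset.sum_le_sum fun k hk => ?_
  rw [abs_mul, abs_of_nonneg (by positivity)]
  exact mul_le_mul_of_nonneg_left (c_close n k (by simp at hk; omega)) (by positivity)

open Filter Topology in
lemma x_tendsto : Tendsto (fun n => b n / a n) atTop (𝓝 Z) := by
  have h1 : Tendsto (fun n : ℕ => ∑ m ∈ range n, 1 / ((m : ℝ) + 1) ^ 3) atTop (𝓝 Z) :=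
    Z_summable.hasSum.tendsto_sum_nat
  have h2 : Tendsto (fun n : ℕ => Z / ((n : ℝ) + 1)) atTop (𝓝 0) := by
    have := tendsto_one_div_add_atTop_nhds_zero_nat (𝕜 := ℝ)
    have h := this.const_mul Z
    simpa [div_eq_mul_inv] using h
  have h3 := squeeze_zero_norm (fun n => (Real.norm_eq_abs _).trans_le (x_close n)) h2
  have h4 := h3.add h1
  simpa using h4

lemma x_step (n : ℕ) : b (n + 1) / a (n + 1) - b n / a n = 6 / (((n : ℝ) + 1) ^ 3 * (a n * a (n + 1))) := by
  have h := casorati n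
  have h1 := a_pos n
  have h2 := a_pos (n + 1)
  rw [eq_div_iff (by positivity)] at h ⊢
  field_simp
  linear_combination h

lemma x_lt (n : ℕ) : b n / a n < b (n + 1) / a (n + 1) := by
  have h := x_step n
  have h1 := a_pos n
  have h2 := a_pos (n + 1)
  have : 0 < 6 / (((n : ℝ) + 1) ^ 3 * (a n * a (n + 1))) := by positivity
  linarith

lemma x_lt_Z (n : ℕ) : b n / a n < Z :=
  (x_lt n).trans_le ((monotone_nat_of_le_succ fun n => (x_lt n).le).ge_of_tendsto x_tendsto (n + 1))

lemma y_step (n : ℕ) (hn : 102 ≤ n) :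
    b (n + 1) / a (n + 1) + 4 / a (n + 1) ^ 2 ≤ b n / a n + 4 / a n ^ 2 := by
  have h := x_step n
  have h1 := a_pos n
  have h2 := a_pos (n + 1)
  have h3 : 33 * a n ≤ a (n + 1) := by
    obtain ⟨m, rfl⟩ : ∃ m, n = m + 1 := ⟨n - 1, by omega⟩
    exact a_ratio m (by omega)
  have i1 : 6 / (((n : ℝ) + 1) ^ 3 * (a n * a (n + 1))) ≤ 3 / a n ^ 2 := by
    rw [div_le_div_iff₀ (by positivity) (by positivity)]
    have : (1 : ℝ) ≤ ((n : ℝ) + 1) ^ 3 := one_le_pow₀ (by linarith [(Nat.cast_nonneg n : (0 : ℝ) ≤ n)])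
    have j1 : a n * (2 * a n) ≤ a n * a (n + 1) := by gcongr; linarith
    have j2 : 1 * (a n * a (n + 1)) ≤ ((n : ℝ) + 1) ^ 3 * (a n * a (n + 1)) := by gcongr
    nlinarith
  have i2 : 4 / a (n + 1) ^ 2 ≤ 1 / a n ^ 2 := by
    rw [div_le_div_iff₀ (by positivity) (by positivity)]
    nlinarith
  have i3 : 4 / a n ^ 2 = 3 / a n ^ 2 + 1 / a n ^ 2 := by ring
  linarith

lemma Z_le (n : ℕ) (hn : 102 ≤ n) : Z ≤ b n / a n + 4 / a n ^ 2 := by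
  refine le_of_tendsto x_tendsto ?_
  filter_upwards [Filter.eventually_ge_atTop n] with m hm
  have : b m / a m + 4 / a m ^ 2 ≤ b n / a n + 4 / a n ^ 2 := by
    induction m, hm using Nat.le_induction with
    | base => exact le_rfl
    | succ m hm ih => exact (y_step m (by omega)).trans ih
  have h2 := a_pos m
  have : 0 < 4 / a m ^ 2 := by positivity
  linarith

lemma irr : Irrational Z := by
  rintro ⟨q, hq⟩
  obtain ⟨K, hK, hb⟩ := lcm_bound
  have hD : (0 : ℝ) < q.den := by exact_mod_cast q.den_pos
  have hqZ : (q.den : ℝ) * Z ∈ S := by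
    refine ⟨q.num, ?_⟩
    rw [← hq, eq_intCast]
    have := Rat.den_mul_eq_num q
    exact_mod_cast this.symm
  obtain ⟨D, hDq⟩ : ∃ D : ℝ, D = (q.den : ℝ) := ⟨_, rfl⟩
  rw [← hDq] at hD hqZ
  have key : ∀ j : ℕ, 1 ≤ 8 * D * (K * (16 / 5) ^ 102) ^ 3 * (4096 / 4125) ^ j := by
    intro j
    set n := 102 + j with hn
    have h1 := x_lt_Z n
    have h2 := Z_le n (by omega)
    have ha := a_pos n
    have hd : (0 : ℝ) < Nat.lcmUpto n := by exact_mod_cast Nat.lcmUpto_pos n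
    have hg := a_growth j
    rw [← hn] at hg
    have h3 : 0 < a n * Z - b n := by
      rw [div_lt_iff₀ ha] at h1; linarith
    have h4 : a n * Z - b n ≤ 4 / a n := by
      have := mul_le_mul_of_nonneg_left h2 ha.le
      have e : a n * (b n / a n + 4 / a n ^ 2) = b n + 4 / a n := by field_simp
      linarith
    have h5 : 2 * (Nat.lcmUpto n : ℝ) ^ 3 * D * (a n * Z - b n) ∈ S := by
      have m1 := S.mul_mem (S.mul_mem (S.mul_mem (nat_mem 2) (S.pow_mem (nat_mem (Nat.lcmUpto n)) 3)) (a_mem n)) hqZ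
      have m2 := S.mul_mem (nat_mem q.den) (b_mem n)
      rw [← hDq] at m2
      convert S.sub_mem m1 m2 using 1
      push_cast; ring
    have h6 := one_le_of_mem h5 (by positivity)
    have h7 : 4 / a n ≤ 4 / 33 ^ j := by gcongr
    calc (1 : ℝ) ≤ 2 * (Nat.lcmUpto n : ℝ) ^ 3 * D * (a n * Z - b n) := h6
      _ ≤ 2 * (K * (16 / 5) ^ n) ^ 3 * D * (4 / 33 ^ j) := by
          gcongr
          · exact hb n
          · exact h4.trans h7
      _ = 8 * D * (K * (16 / 5) ^ 102) ^ 3 * (4096 / 4125) ^ j := by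
          rw [hn, pow_add, show (4096 / 4125 : ℝ) = (16 / 5) ^ 3 / 33 by norm_num,
            div_pow _ (33 : ℝ) j, ← pow_mul _ 3 j, mul_comm 3 j, pow_mul _ j 3]
          generalize (16 / 5 : ℝ) ^ 102 = X
          generalize (16 / 5 : ℝ) ^ j = Y
          ring
  have hC : 0 < 8 * D * (K * (16 / 5) ^ 102) ^ 3 := by positivity
  generalize 8 * D * (K * (16 / 5) ^ 102) ^ 3 = C at key hC
  obtain ⟨j, hj⟩ := exists_pow_lt_of_lt_one (show (0 : ℝ) < 1 / C by positivity)
    (show (4096 / 4125 : ℝ) < 1 by norm_num)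
  have := key j
  rw [lt_div_iff₀ hC] at hj
  linarith

end Apery

/-- Apéry's theorem: ζ(3) = ∑_{n≥1} 1/n³ is irrational. -/
theorem zeta_three_irrational : Irrational (∑' n : ℕ, 1 / ((n : ℝ) + 1) ^ 3) :=
  Apery.irr
end
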